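/- Let m > 0, ν ∈ (0, 1/m], λ ∈ [0, (1 + νm)/2), and let c > 0 satisfy (1 − 2λ)·J_ν(2c/m) + 2c·J′_ν(2c/m) = 0 with 2c/m ∈ (0, j_ν). Let a < b and let f be absolutely continuous on [a, b] with f(a) = f(b) = 0 and f′/δ ∈ L¹[a, b]. Then ((1 − ν²m²)/4)·∫ₐᵇ |f(x)|/δ(x)² dx + (c²/δ₀^m)·∫ₐᵇ |f(x)|/δ(x)^{2−m} dx ≤ ((1 + νm)/2 − λ²)·∫ₐᵇ |f′(x)|/δ(x) dx + ((λ² − λ)/δ₀)·∫ₐᵇ |f′(x)| dx. -/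

import Mathlib

open MeasureTheory Real Set Filter

/-- Bessel function of the first kind of real order `ν`, defined for `x > 0` by its series. -/
noncomputable def besselJ (ν x : ℝ) : ℝ :=
  ∑' k : ℕ, (-1 : ℝ) ^ k * x ^ (2 * (k : ℝ) + ν) /
    (2 ^ (2 * (k : ℝ) + ν) * (Nat.factorial k : ℝ) * Real.Gamma ((k : ℝ) + 1 + ν))

/-- The entire function `s ↦ ∑ (-s)^k / (k! Γ(k+1+ν))`, for which
`J_ν(x) = (x/2)^ν * besselE ν (x^2/4)`. -/
noncomputable def besselE (ν s : ℝ) : ℝ :=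
  ∑' k : ℕ, (-1 : ℝ) ^ k * s ^ k / ((Nat.factorial k : ℝ) * Real.Gamma ((k : ℝ) + 1 + ν))

lemma gamma_one_add_le {ν : ℝ} (hν : 0 ≤ ν) (k : ℕ) :
    Real.Gamma (1 + ν) ≤ Real.Gamma ((k : ℝ) + 1 + ν) := by
  induction k with
  | zero => simp
  | succ k ih =>
    have hk : (0 : ℝ) ≤ k := k.cast_nonneg
    have hpos : 0 < (k : ℝ) + 1 + ν := by positivity
    have h := Real.Gamma_add_one hpos.ne'
    have hG := Real.Gamma_pos_of_pos hpos
    have e : ((k + 1 : ℕ) : ℝ) + 1 + ν = (k : ℝ) + 1 + ν + 1 := by push_cast; ring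
    rw [e, h]
    nlinarith

lemma summable_besselE {ν : ℝ} (hν : 0 ≤ ν) (s : ℝ) :
    Summable fun k : ℕ =>
      (-1 : ℝ) ^ k * s ^ k / ((Nat.factorial k : ℝ) * Real.Gamma ((k : ℝ) + 1 + ν)) := by
  have hG : 0 < Real.Gamma (1 + ν) := Real.Gamma_pos_of_pos (by linarith)
  refine Summable.of_norm_bounded
    (g := fun k : ℕ => |s| ^ k / (Nat.factorial k : ℝ) / Real.Gamma (1 + ν))
    ((Real.summable_pow_div_factorial |s|).div_const _) fun k => ?_
  have hk := gamma_one_add_le hν k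
  have hf : (0 : ℝ) < Nat.factorial k := by positivity
  rw [norm_div, norm_mul, norm_pow, norm_pow, norm_mul, Real.norm_eq_abs, Real.norm_eq_abs,
    Real.norm_eq_abs, Real.norm_eq_abs, abs_neg, abs_one, one_pow, one_mul, abs_of_pos hf,
    abs_of_pos (hG.trans_le hk), div_div]
  gcongr

lemma hasDerivAt_besselE {ν : ℝ} (hν : 0 ≤ ν) (s : ℝ) :
    HasDerivAt (besselE ν) (-besselE (ν + 1) s) s := by
  have hG : 0 < Real.Gamma (1 + ν) := Real.Gamma_pos_of_pos (by linarith)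
  set R : ℝ := |s| + 1 with hR
  have hRpos : 0 < R := by positivity
  have hshift : ∀ k : ℕ, (-1 : ℝ) ^ (k + 1) * (((k + 1 : ℕ) : ℝ) * s ^ (k + 1 - 1)) /
      ((Nat.factorial (k + 1) : ℝ) * Real.Gamma (((k + 1 : ℕ) : ℝ) + 1 + ν)) =
      -((-1 : ℝ) ^ k * s ^ k /
        ((Nat.factorial k : ℝ) * Real.Gamma ((k : ℝ) + 1 + (ν + 1)))) := fun k => by
    have e : ((k + 1 : ℕ) : ℝ) + 1 + ν = (k : ℝ) + 1 + (ν + 1) := by push_cast; ring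
    have hk : ((k : ℝ) + 1) ≠ 0 := by positivity
    rw [e, Nat.factorial_succ, pow_succ]
    push_cast
    rw [show (-1 : ℝ) ^ k * -1 * ((↑k + 1) * s ^ k) = (k + 1) * (-((-1 : ℝ) ^ k * s ^ k)) by ring,
      mul_assoc, mul_div_mul_left _ _ hk, neg_div]
  have hder := hasDerivAt_tsum_of_isPreconnected (𝕜 := ℝ) (F := ℝ)
    (g := fun (k : ℕ) (x : ℝ) =>
      (-1 : ℝ) ^ k * x ^ k / ((Nat.factorial k : ℝ) * Real.Gamma ((k : ℝ) + 1 + ν)))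
    (g' := fun (k : ℕ) (x : ℝ) =>
      (-1 : ℝ) ^ k * (k * x ^ (k - 1)) /
        ((Nat.factorial k : ℝ) * Real.Gamma ((k : ℝ) + 1 + ν)))
    (u := fun k : ℕ => k * R ^ (k - 1) / (Nat.factorial k : ℝ) / Real.Gamma (1 + ν))
    (t := Metric.ball 0 R) (y₀ := s) (y := s) ?_ Metric.isOpen_ball
    (convex_ball 0 R).isPreconnected ?_ ?_ ?_ (summable_besselE hν s) ?_
  · refine hder.congr_deriv ?_
    rw [tsum_eq_zero_add'
      (((summable_besselE (by linarith : 0 ≤ ν + 1) s).neg).congr fun k => (hshift k).symm)]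
    simp only [CharP.cast_eq_zero, zero_mul, mul_zero, zero_div, zero_add]
    rw [besselE, ← tsum_neg]
    exact tsum_congr hshift
  · rw [← summable_nat_add_iff 1]
    refine ((Real.summable_pow_div_factorial R).div_const (Real.Gamma (1 + ν))).congr fun k => ?_
    have hk : ((k : ℝ) + 1) ≠ 0 := by positivity
    rw [Nat.factorial_succ]
    push_cast
    rw [mul_div_mul_left _ _ hk]
  · intro k x _
    exact ((hasDerivAt_pow k x).const_mul _).div_const _
  · intro k x hx
    have hx' : |x| ≤ R := by simpa using (mem_ball_zero_iff.1 hx).le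
    have hk := gamma_one_add_le hν k
    have hf : (0 : ℝ) < Nat.factorial k := by positivity
    rw [norm_div, norm_mul, norm_pow, norm_mul, norm_pow, norm_mul, Real.norm_eq_abs,
      Real.norm_eq_abs, Real.norm_eq_abs, Real.norm_eq_abs, Real.norm_eq_abs, abs_neg, abs_one,
      one_pow, one_mul, abs_of_pos hf, abs_of_pos (hG.trans_le hk), div_div, Nat.abs_cast]
    gcongr
  · rw [mem_ball_zero_iff, Real.norm_eq_abs]; linarith
  · rw [mem_ball_zero_iff, Real.norm_eq_abs]; linarith

lemma besselE_recurrence {ν : ℝ} (hν : 0 ≤ ν) (s : ℝ) :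
    s * besselE (ν + 2) s - (ν + 1) * besselE (ν + 1) s + besselE ν s = 0 := by
  have h0 := summable_besselE hν s
  have h1 := summable_besselE (by linarith : 0 ≤ ν + 1) s
  have hdiff : besselE ν s - (ν + 1) * besselE (ν + 1) s = -(s * besselE (ν + 2) s) := by
    rw [besselE, besselE, besselE, ← tsum_mul_left, ← tsum_mul_left, ← tsum_neg,
      ← h0.tsum_sub (h1.mul_left (ν + 1)), (h0.sub (h1.mul_left (ν + 1))).tsum_eq_zero_add]
    have hz : Real.Gamma (1 + (ν + 1)) = (1 + ν) * Real.Gamma (1 + ν) := by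
      rw [← Real.Gamma_add_one (by positivity)]; ring_nf
    have hG : Real.Gamma (1 + ν) ≠ 0 := (Real.Gamma_pos_of_pos (by linarith)).ne'
    have hν1 : 1 + ν ≠ 0 := by positivity
    have hfirst : (-1 : ℝ) ^ 0 * s ^ 0 / ((Nat.factorial 0 : ℝ) * Real.Gamma (((0 : ℕ) : ℝ) + 1 + ν))
        - (ν + 1) * ((-1 : ℝ) ^ 0 * s ^ 0 /
          ((Nat.factorial 0 : ℝ) * Real.Gamma (((0 : ℕ) : ℝ) + 1 + (ν + 1)))) = 0 := by
      simp only [pow_zero, Nat.factorial_zero, Nat.cast_one, Nat.cast_zero, zero_add, one_mul, hz]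
      field_simp
      ring
    rw [hfirst, zero_add]
    refine tsum_congr fun k => ?_
    have hpos : (0 : ℝ) < (k : ℝ) + 2 + ν := by positivity
    have e1 : ((k + 1 : ℕ) : ℝ) + 1 + ν = (k : ℝ) + 2 + ν := by push_cast; ring
    have e2 : ((k + 1 : ℕ) : ℝ) + 1 + (ν + 1) = (k : ℝ) + 2 + ν + 1 := by push_cast; ring
    have e3 : (k : ℝ) + 1 + (ν + 2) = (k : ℝ) + 2 + ν + 1 := by ring
    rw [e1, e2, e3, Real.Gamma_add_one hpos.ne', Nat.factorial_succ]
    have hGk := (Real.Gamma_pos_of_pos hpos).ne'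
    have hf : (Nat.factorial k : ℝ) ≠ 0 := by positivity
    have hk : ((k : ℝ) + 1) ≠ 0 := by positivity
    have hpos' := hpos.ne'
    push_cast
    field_simp
    ring
  linarith

lemma besselJ_eq {ν x : ℝ} (hx : 0 < x) :
    besselJ ν x = (x / 2) ^ ν * besselE ν (x ^ 2 / 4) := by
  rw [besselJ, besselE, ← tsum_mul_left]
  refine tsum_congr fun k => ?_
  have h2 : (0 : ℝ) < 2 := two_pos
  rw [Real.rpow_add hx, Real.rpow_add h2, Real.rpow_mul hx.le, Real.rpow_mul h2.le,
    Real.rpow_natCast, Real.rpow_natCast, Real.rpow_two, Real.rpow_two, Real.div_rpow hx.le h2.le,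
    div_pow, show (2 : ℝ) ^ 2 = 4 by norm_num]
  simp only [div_eq_mul_inv, mul_inv]
  ring

lemma hasDerivAt_besselJ {ν x : ℝ} (hν : 0 ≤ ν) (hx : 0 < x) :
    HasDerivAt (besselJ ν)
      ((x / 2) ^ ν * (ν / x * besselE ν (x ^ 2 / 4) - x / 2 * besselE (ν + 1) (x ^ 2 / 4))) x := by
  have h1 : HasDerivAt (fun y : ℝ => (y / 2) ^ ν) (1 / 2 * ν * (x / 2) ^ (ν - 1)) x :=
    ((hasDerivAt_id x).div_const 2).rpow_const (Or.inl (by simpa using hx.ne'))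
  have h2 : HasDerivAt (fun y : ℝ => y ^ 2 / 4) (2 * x / 4) x := by
    simpa using (hasDerivAt_pow 2 x).div_const 4
  have h3 := h1.mul (((hasDerivAt_besselE hν (x ^ 2 / 4)).comp x h2))
  have hEq : besselJ ν =ᶠ[nhds x]
      (fun y : ℝ => (y / 2) ^ ν) * (besselE ν ∘ fun y : ℝ => y ^ 2 / 4) := by
    filter_upwards [lt_mem_nhds hx] with y hy
    exact besselJ_eq hy
  refine (h3.congr_of_eventuallyEq hEq).congr_deriv ?_
  rw [Real.rpow_sub_one (by positivity)]
  simp only [Function.comp_apply]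
  field_simp
  ring

/-- Monotonicity on `[0, S]` of `s ↦ -s E'(s) / E(s)` for the solution `E` of
`s E'' + (ν + 1) E' + E = 0`, together with its Riccati equation. -/
lemma besselE_logDeriv {ν S : ℝ} (hν : 0 < ν) (hE : ∀ s ∈ Icc 0 S, 0 < besselE ν s) :
    (∀ s ∈ Icc 0 S, HasDerivAt (fun s => s * besselE (ν + 1) s / besselE ν s)
      ((besselE (ν + 1) s - s * besselE (ν + 2) s) / besselE ν s
        + s * (besselE (ν + 1) s / besselE ν s) ^ 2) s) ∧
    MonotoneOn (fun s => s * besselE (ν + 1) s / besselE ν s) (Icc 0 S) := by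
  have d0 := hasDerivAt_besselE hν.le
  have d1 : ∀ s, HasDerivAt (besselE (ν + 1)) (-besselE (ν + 2) s) s := fun s => by
    have h := hasDerivAt_besselE (by linarith : 0 ≤ ν + 1) s
    rwa [show ν + 1 + 1 = ν + 2 by ring] at h
  have hrec := besselE_recurrence hν.le
  have hd : ∀ s ∈ Icc 0 S, HasDerivAt (fun s => s * besselE (ν + 1) s / besselE ν s)
      ((besselE (ν + 1) s - s * besselE (ν + 2) s) / besselE ν s
        + s * (besselE (ν + 1) s / besselE ν s) ^ 2) s := by
    intro s hs
    have hne := (hE s hs).ne'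
    refine (((hasDerivAt_id s).mul (d1 s)).div (d0 s) hne).congr_deriv ?_
    simp only [id, Pi.mul_apply]
    field_simp
    ring
  refine ⟨hd, ?_⟩
  set G : ℝ → ℝ := fun s => s ^ ν * ((s * besselE (ν + 1) s) ^ 2
    - ν * s * besselE ν s * besselE (ν + 1) s + s * besselE ν s ^ 2) with hG
  have c0 : Continuous (besselE ν) := continuous_iff_continuousAt.2 fun s => (d0 s).continuousAt
  have c1 : Continuous (besselE (ν + 1)) :=
    continuous_iff_continuousAt.2 fun s => (d1 s).continuousAt
  have hGc : ContinuousOn G (Icc 0 S) := by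
    refine Continuous.continuousOn ?_
    have : Continuous fun s : ℝ => s ^ ν := Real.continuous_rpow_const hν.le
    fun_prop
  have hGd : ∀ s ∈ interior (Icc 0 S), HasDerivAt G (s ^ ν * besselE ν s ^ 2) s := by
    intro s hs
    rw [interior_Icc] at hs
    have hs0 : s ≠ 0 := hs.1.ne'
    have h1 := hasDerivAt_rpow_const (p := ν) (Or.inl hs0)
    have h2 := (((hasDerivAt_id s).mul (d1 s)).pow 2).sub
      ((((hasDerivAt_id s).const_mul ν).mul (d0 s)).mul (d1 s))
    have h3 := h2.add ((hasDerivAt_id s).mul ((d0 s).pow 2))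
    refine (h1.mul h3).congr_deriv ?_
    rw [Real.rpow_sub_one hs0]
    simp only [id, Pi.mul_apply, Pi.add_apply, Pi.sub_apply, Pi.pow_apply]
    have e : besselE (ν + 2) s = ((ν + 1) * besselE (ν + 1) s - besselE ν s) / s := by
      rw [eq_div_iff hs0]; linarith [hrec s]
    rw [e]
    field_simp
    ring
  have hGm : MonotoneOn G (Icc 0 S) :=
    monotoneOn_of_hasDerivWithinAt_nonneg (convex_Icc 0 S) hGc
      (fun s hs => (hGd s hs).hasDerivWithinAt) fun s hs => by
        rw [interior_Icc] at hs
        have := hs.1.le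
        positivity
  refine monotoneOn_of_hasDerivWithinAt_nonneg (convex_Icc 0 S)
    (fun s hs => (hd s hs).continuousAt.continuousWithinAt)
    (fun s hs => (hd s (interior_subset hs)).hasDerivWithinAt) fun s hs => ?_
  have hsI := interior_subset hs
  rw [interior_Icc] at hs
  have hpos := hE s hsI
  have hGs : 0 ≤ G s := by
    have := hGm ⟨le_rfl, hsI.1.trans hsI.2⟩ hsI hsI.1
    simpa [hG, Real.zero_rpow hν.ne'] using this
  have hH := nonneg_of_mul_nonneg_right hGs (Real.rpow_pos_of_pos hs.1 ν)
  have e : (besselE (ν + 1) s - s * besselE (ν + 2) s) / besselE ν s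
        + s * (besselE (ν + 1) s / besselE ν s) ^ 2 =
      ((s * besselE (ν + 1) s) ^ 2 - ν * s * besselE ν s * besselE (ν + 1) s
        + s * besselE ν s ^ 2) / (s * besselE ν s ^ 2) := by
    have e2 : s * besselE (ν + 2) s = (ν + 1) * besselE (ν + 1) s - besselE ν s := by
      linarith [hrec s]
    have hs0 : s ≠ 0 := hs.1.ne'
    rw [e2]
    field_simp
    ring
  rw [e]
  have := hs.1
  positivity

lemma integrableOn_besselWeight {A C p t h : ℝ} (ht : 0 < t) :
    IntegrableOn (fun x : ℝ => A / x ^ 2 + C / x ^ p) (Icc t h) := by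
  refine ContinuousOn.integrableOn_Icc (ContinuousOn.add ?_ ?_)
  · exact continuousOn_const.div (by fun_prop) fun x hx =>
      pow_ne_zero _ (ht.trans_le hx.1).ne'
  · exact continuousOn_const.div
      (continuousOn_id.rpow_const fun x hx => Or.inl (ht.trans_le hx.1).ne')
      fun x hx => (Real.rpow_pos_of_pos (ht.trans_le hx.1) _).ne'

/-- The tail of the weight `(1 - ν²m²) / (4x²) + c² x^(m-2) / h^m` on `[t, h]` is controlled by the
Riccati variable of `√x J_ν((2c/m)(x/h)^(m/2))`. -/
lemma integral_besselWeight_le {m ν lam c h t : ℝ} (hm : 0 < m) (hν : 0 < ν) (hlam : 0 ≤ lam)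
    (hc : 0 < c) (hE : ∀ s ∈ Icc 0 ((c / m) ^ 2), 0 < besselE ν s)
    (hroot : lam = (1 + ν * m) / 2
      - m * ((c / m) ^ 2 * besselE (ν + 1) ((c / m) ^ 2) / besselE ν ((c / m) ^ 2)))
    (ht : 0 < t) (hth : t ≤ h) :
    ∫ x in t..h, ((1 - ν ^ 2 * m ^ 2) / 4 / x ^ 2 + c ^ 2 / h ^ m / x ^ (2 - m)) ≤
      ((1 + ν * m) / 2 - lam ^ 2) / t + (lam ^ 2 - lam) / h := by
  obtain ⟨hd, hmono⟩ := besselE_logDeriv hν hE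
  have hrec := besselE_recurrence hν.le
  have hh : 0 < h := ht.trans_le hth
  set S : ℝ := (c / m) ^ 2 with hS
  have hSpos : 0 < S := by positivity
  set w : ℝ → ℝ := fun s => s * besselE (ν + 1) s / besselE ν s with hw
  set k : ℝ := (1 + ν * m) / 2 with hk
  set σ : ℝ → ℝ := fun x => S * (x / h) ^ m with hσ
  have hσmem : ∀ x ∈ Icc t h, σ x ∈ Icc 0 S := fun x hx => by
    have hx0 : 0 < x := ht.trans_le hx.1
    have h1 : (x / h) ^ m ≤ 1 := Real.rpow_le_one (by positivity) ((div_le_one hh).2 hx.2) hm.le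
    exact ⟨by positivity, by simpa [hσ] using mul_le_mul_of_nonneg_left h1 hSpos.le⟩
  have hσd : ∀ x ∈ Icc t h, HasDerivAt σ (m * σ x / x) x := fun x hx => by
    have hx0 : 0 < x := ht.trans_le hx.1
    have hxh : x / h ≠ 0 := by positivity
    refine ((((hasDerivAt_id x).div_const h).rpow_const (p := m) (Or.inl hxh)).const_mul
      S).congr_deriv ?_
    simp only [id, hσ]
    rw [Real.rpow_sub_one hxh]
    field_simp
  set L : ℝ → ℝ := fun x => (lam ^ 2 - (k - m * w (σ x))) / x with hL
  set L' : ℝ → ℝ := fun x => (m ^ 2 * (w (σ x) ^ 2 - ν * w (σ x) + σ x)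
    - (lam ^ 2 - (k - m * w (σ x)))) / x ^ 2 with hL'
  have hLd : ∀ x ∈ Icc t h, HasDerivAt L (L' x) x := fun x hx => by
    have hx0 : 0 < x := ht.trans_le hx.1
    have hne := (hE _ (hσmem x hx)).ne'
    have h1 := (hd _ (hσmem x hx)).comp x (hσd x hx)
    have h2 := (((h1.const_mul m).const_sub k).const_sub (lam ^ 2)).div (hasDerivAt_id x) hx0.ne'
    refine h2.congr_deriv ?_
    have e : besselE (ν + 1) (σ x) - σ x * besselE (ν + 2) (σ x) =
        besselE ν (σ x) - ν * besselE (ν + 1) (σ x) := by linarith [hrec (σ x)]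
    simp only [id, hL', hw, Function.comp_apply]
    rw [e]
    field_simp
    ring
  have key := intervalIntegral.integral_le_sub_of_hasDeriv_right_of_le hth
    (fun x hx => (hLd x hx).continuousAt.continuousWithinAt)
    (fun x hx => (hLd x (Ioo_subset_Icc_self hx)).hasDerivWithinAt)
    (integrableOn_besselWeight (A := (1 - ν ^ 2 * m ^ 2) / 4) (C := c ^ 2 / h ^ m) (p := 2 - m) ht) ?_
  · refine key.trans ?_
    have hσh : σ h = S := by simp [hσ, div_self hh.ne']
    have hwt : 0 ≤ w (σ t) := by
      have := hmono ⟨le_rfl, hSpos.le⟩ (hσmem t ⟨le_rfl, hth⟩) (hσmem t ⟨le_rfl, hth⟩).1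
      simpa [hw] using this
    have hLh : L h = (lam ^ 2 - lam) / h := by
      simp only [hL, hσh]
      rw [hroot]
    have hLt : -L t ≤ (k - lam ^ 2) / t := by
      simp only [hL]
      rw [← neg_div]
      gcongr
      nlinarith
    rw [hLh]
    linarith
  · intro x hx
    have hxI := Ioo_subset_Icc_self hx
    have hx0 : 0 < x := ht.trans hx.1
    have hwx : lam ≤ k - m * w (σ x) := by
      have h1 : w (σ x) ≤ w S := hmono (hσmem x hxI) ⟨hSpos.le, le_rfl⟩ (hσmem x hxI).2
      have h2 := mul_le_mul_of_nonneg_left h1 hm.le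
      have h3 : lam = k - m * w S := hroot
      linarith
    have hweight : c ^ 2 / h ^ m / x ^ (2 - m) = m ^ 2 * σ x / x ^ 2 := by
      have hhm := (Real.rpow_pos_of_pos hh m).ne'
      have hxm := (Real.rpow_pos_of_pos hx0 m).ne'
      simp only [hσ, hS]
      rw [Real.rpow_sub hx0, Real.rpow_two, Real.div_rpow hx0.le hh.le]
      field_simp
    rw [hweight, ← add_div]
    simp only [hL']
    gcongr
    have hsq : lam ^ 2 ≤ (k - m * w (σ x)) ^ 2 := by gcongr
    nlinarith [hsq, hk]

/-- A weighted Hardy inequality: if the tails `∫ x in (t, h), q x` of a nonnegative weight are at most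
`R t`, then `∫ q |g| ≤ ∫ R |g'|` for `g` with `|g x| ≤ ∫ t in (0, x), |g' t|`. -/
lemma integral_weight_mul_abs_le {h : ℝ} {q R g g' : ℝ → ℝ} (hqm : Measurable q)
    (hq : ∀ x ∈ Ioo 0 h, 0 ≤ q x) (hqi : ∀ t ∈ Ioo 0 h, IntegrableOn q (Ioo t h))
    (hqR : ∀ t ∈ Ioo 0 h, ∫ x in Ioo t h, q x ≤ R t)
    (hgc : ContinuousOn g (Ioo 0 h)) (hg' : IntegrableOn g' (Ioo 0 h))
    (hg : ∀ x ∈ Ioo 0 h, |g x| ≤ ∫ t in Ioo 0 x, |g' t|)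
    (hRi : IntegrableOn (fun t => R t * |g' t|) (Ioo 0 h)) :
    IntegrableOn (fun x => q x * |g x|) (Ioo 0 h) ∧
      ∫ x in Ioo 0 h, q x * |g x| ≤ ∫ t in Ioo 0 h, R t * |g' t| := by
  have hR0 : ∀ t ∈ Ioo 0 h, 0 ≤ R t := fun t ht =>
    (setIntegral_nonneg measurableSet_Ioo fun x hx => hq x ⟨ht.1.trans hx.1, hx.2⟩).trans
      (hqR t ht)
  have hmeas : AEStronglyMeasurable (fun x => q x * |g x|) (volume.restrict (Ioo 0 h)) :=
    hqm.aestronglyMeasurable.mul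
      (hgc.aestronglyMeasurable measurableSet_Ioo).norm
  have hnn : 0 ≤ᵐ[volume.restrict (Ioo 0 h)] fun x => q x * |g x| := by
    filter_upwards [ae_restrict_mem measurableSet_Ioo] with x hx
    exact mul_nonneg (hq x hx) (abs_nonneg _)
  have hRnn : 0 ≤ᵐ[volume.restrict (Ioo 0 h)] fun x => R x * |g' x| := by
    filter_upwards [ae_restrict_mem measurableSet_Ioo] with x hx
    exact mul_nonneg (hR0 x hx) (abs_nonneg _)
  set F : ℝ → ℝ → ENNReal := fun x t =>
    {p : ℝ × ℝ | p.2 < p.1}.indicator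
      (fun p => ENNReal.ofReal (q p.1) * ENNReal.ofReal |g' p.2|) (x, t) with hF
  have hFm : AEMeasurable (Function.uncurry F)
      ((volume.restrict (Ioo 0 h)).prod (volume.restrict (Ioo 0 h))) := by
    have h1 : AEMeasurable (fun p : ℝ × ℝ => ENNReal.ofReal (q p.1) * ENNReal.ofReal |g' p.2|)
        ((volume.restrict (Ioo 0 h)).prod (volume.restrict (Ioo 0 h))) := by
      refine AEMeasurable.mul (hqm.comp measurable_fst).ennreal_ofReal.aemeasurable ?_
      exact (hg'.abs.aestronglyMeasurable.aemeasurable.ennreal_ofReal).comp_snd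
    exact h1.indicator (measurableSet_lt measurable_snd measurable_fst)
  have hle : ∫⁻ x in Ioo 0 h, ENNReal.ofReal (q x * |g x|) ≤
      ∫⁻ t in Ioo 0 h, ENNReal.ofReal (R t * |g' t|) := by
    calc ∫⁻ x in Ioo 0 h, ENNReal.ofReal (q x * |g x|)
        ≤ ∫⁻ x in Ioo 0 h, ∫⁻ t in Ioo 0 h, F x t := by
          refine setLIntegral_mono' measurableSet_Ioo fun x hx => ?_
          have e : ∀ t, F x t = (Iio x).indicator
              (fun t => ENNReal.ofReal (q x) * ENNReal.ofReal |g' t|) t := fun t => by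
            simp [hF, indicator_apply]
          have hsub : Iio x ∩ Ioo 0 h = Ioo 0 x := by
            ext t
            simp only [mem_inter_iff, mem_Iio, mem_Ioo]
            exact ⟨fun H => ⟨H.2.1, H.1⟩, fun H => ⟨H.2, H.1, H.2.trans hx.2⟩⟩
          simp_rw [e]
          rw [lintegral_indicator measurableSet_Iio, Measure.restrict_restrict measurableSet_Iio,
            hsub, lintegral_const_mul' _ _ ENNReal.ofReal_ne_top, ENNReal.ofReal_mul (hq x hx)]
          gcongr
          rw [← ofReal_integral_eq_lintegral_ofReal
            (hg'.mono_set (Ioo_subset_Ioo_right hx.2.le)).abs (ae_of_all _ fun t => abs_nonneg _)]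
          exact ENNReal.ofReal_le_ofReal (hg x hx)
      _ = ∫⁻ t in Ioo 0 h, ∫⁻ x in Ioo 0 h, F x t := lintegral_lintegral_swap hFm
      _ ≤ ∫⁻ t in Ioo 0 h, ENNReal.ofReal (R t * |g' t|) := by
          refine setLIntegral_mono' measurableSet_Ioo fun t ht => ?_
          have e : ∀ x, F x t = (Ioi t).indicator
              (fun x => ENNReal.ofReal (q x) * ENNReal.ofReal |g' t|) x := fun x => by
            simp [hF, indicator_apply]
          have hsub : Ioi t ∩ Ioo 0 h = Ioo t h := by
            ext x
            simp only [mem_inter_iff, mem_Ioi, mem_Ioo]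
            exact ⟨fun H => ⟨H.1, H.2.2⟩, fun H => ⟨H.1, ht.1.trans H.1, H.2⟩⟩
          simp_rw [e]
          rw [lintegral_indicator measurableSet_Ioi, Measure.restrict_restrict measurableSet_Ioi,
            hsub, lintegral_mul_const' _ _ ENNReal.ofReal_ne_top, ENNReal.ofReal_mul (hR0 t ht)]
          gcongr
          rw [← ofReal_integral_eq_lintegral_ofReal (hqi t ht)]
          · exact ENNReal.ofReal_le_ofReal (hqR t ht)
          · filter_upwards [ae_restrict_mem measurableSet_Ioo] with x hx
            exact hq x ⟨ht.1.trans hx.1, hx.2⟩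
  have hfin : ∫⁻ t in Ioo 0 h, ENNReal.ofReal (R t * |g' t|) < ⊤ :=
    (hasFiniteIntegral_iff_ofReal hRnn).1 hRi.2
  refine ⟨⟨hmeas, (hasFiniteIntegral_iff_ofReal hnn).2 (hle.trans_lt hfin)⟩, ?_⟩
  rw [integral_eq_lintegral_of_nonneg_ae hnn hmeas,
    integral_eq_lintegral_of_nonneg_ae hRnn hRi.1]
  exact ENNReal.toReal_mono hfin.ne hle

/-- The one-sided inequality on `(0, h)` for a function vanishing at `0`. -/
lemma besselHardy_halfInterval {m ν lam c h : ℝ} {g g' : ℝ → ℝ} (hm : 0 < m) (hν : 0 < ν)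
    (hνm : ν * m ≤ 1) (hlam : 0 ≤ lam) (hc : 0 < c)
    (hE : ∀ s ∈ Icc 0 ((c / m) ^ 2), 0 < besselE ν s)
    (hroot : lam = (1 + ν * m) / 2
      - m * ((c / m) ^ 2 * besselE (ν + 1) ((c / m) ^ 2) / besselE ν ((c / m) ^ 2)))
    (hh : 0 < h) (hgc : ContinuousOn g (Ioo 0 h)) (hg' : IntegrableOn g' (Ioo 0 h))
    (hg'x : IntegrableOn (fun x => g' x / x) (Ioo 0 h))
    (hg : ∀ x ∈ Ioo 0 h, |g x| ≤ ∫ t in Ioo 0 x, |g' t|) :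
    IntegrableOn (fun x => (1 - ν ^ 2 * m ^ 2) / 4 * (|g x| / x ^ 2)) (Ioo 0 h) ∧
    IntegrableOn (fun x => c ^ 2 / h ^ m * (|g x| / x ^ (2 - m))) (Ioo 0 h) ∧
    (∫ x in Ioo 0 h, (1 - ν ^ 2 * m ^ 2) / 4 * (|g x| / x ^ 2))
      + (∫ x in Ioo 0 h, c ^ 2 / h ^ m * (|g x| / x ^ (2 - m))) ≤
    ((1 + ν * m) / 2 - lam ^ 2) * (∫ x in Ioo 0 h, |g' x| / x)
      + (lam ^ 2 - lam) / h * (∫ x in Ioo 0 h, |g' x|) := by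
  have hA : 0 ≤ (1 - ν ^ 2 * m ^ 2) / 4 := by
    have : 0 < ν * m := by positivity
    nlinarith
  have hC : 0 ≤ c ^ 2 / h ^ m := by positivity
  have habs : IntegrableOn (fun x => |g' x| / x) (Ioo 0 h) := by
    refine (integrableOn_congr_fun (fun x hx => ?_) measurableSet_Ioo).1 hg'x.abs
    rw [abs_div, abs_of_pos hx.1]
  have hmul : ∀ x, (((1 + ν * m) / 2 - lam ^ 2) / x + (lam ^ 2 - lam) / h) * |g' x| =
      ((1 + ν * m) / 2 - lam ^ 2) * (|g' x| / x) + (lam ^ 2 - lam) / h * |g' x| := fun x => by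
    ring
  have hi1 := habs.const_mul ((1 + ν * m) / 2 - lam ^ 2)
  have hi2 := hg'.abs.const_mul ((lam ^ 2 - lam) / h)
  obtain ⟨hI, hle⟩ := integral_weight_mul_abs_le (h := h)
    (q := fun x => (1 - ν ^ 2 * m ^ 2) / 4 / x ^ 2 + c ^ 2 / h ^ m / x ^ (2 - m))
    (R := fun t => ((1 + ν * m) / 2 - lam ^ 2) / t + (lam ^ 2 - lam) / h)
    (g := g) (g' := g') (by fun_prop)
    (fun x hx => by have := hx.1; positivity)
    (fun t ht => (integrableOn_besselWeight ht.1).mono_set Ioo_subset_Icc_self)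
    (fun t ht => by
      rw [← integral_Ioc_eq_integral_Ioo, ← intervalIntegral.integral_of_le ht.2.le]
      exact integral_besselWeight_le hm hν hlam hc hE hroot ht.1 ht.2.le)
    hgc hg' hg (by simp_rw [hmul]; exact hi1.add hi2)
  have hsplit : ∀ x : ℝ, ((1 - ν ^ 2 * m ^ 2) / 4 / x ^ 2 + c ^ 2 / h ^ m / x ^ (2 - m)) * |g x| =
      (1 - ν ^ 2 * m ^ 2) / 4 * (|g x| / x ^ 2) + c ^ 2 / h ^ m * (|g x| / x ^ (2 - m)) :=
    fun x => by ring
  have hgm : AEStronglyMeasurable (fun x => |g x|) (volume.restrict (Ioo 0 h)) :=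
    (hgc.aestronglyMeasurable measurableSet_Ioo).norm
  simp_rw [hsplit] at hI hle
  simp_rw [hmul] at hle
  have hI1 : IntegrableOn (fun x => (1 - ν ^ 2 * m ^ 2) / 4 * (|g x| / x ^ 2)) (Ioo 0 h) := by
    refine hI.mono' ((hgm.div₀ (by fun_prop)).const_mul _) ?_
    filter_upwards [ae_restrict_mem measurableSet_Ioo] with x hx
    have := hx.1
    rw [Real.norm_of_nonneg (by positivity)]
    exact le_add_of_nonneg_right (by positivity)
  have hI2 : IntegrableOn (fun x => c ^ 2 / h ^ m * (|g x| / x ^ (2 - m))) (Ioo 0 h) := by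
    refine hI.mono' ((hgm.div₀ (by fun_prop)).const_mul _) ?_
    filter_upwards [ae_restrict_mem measurableSet_Ioo] with x hx
    have := hx.1
    rw [Real.norm_of_nonneg (by positivity)]
    exact le_add_of_nonneg_left (by positivity)
  refine ⟨hI1, hI2, ?_⟩
  rw [integral_add hI1 hI2, integral_add hi1 hi2, integral_const_mul _ (fun x => |g' x| / x),
    integral_const_mul _ (fun x => |g' x|)] at hle
  exact hle

lemma integral_Ioo_eq_add_halves {a b : ℝ} {Φ L R : ℝ → ℝ} (hab : a < b)
    (hL : ∀ x ∈ Ioo 0 ((b - a) / 2), Φ (a + x) = L x)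
    (hR : ∀ x ∈ Ioo 0 ((b - a) / 2), Φ (b - x) = R x)
    (hLi : IntegrableOn L (Ioo 0 ((b - a) / 2))) (hRi : IntegrableOn R (Ioo 0 ((b - a) / 2))) :
    ∫ x in Ioo a b, Φ x =
      (∫ x in Ioo 0 ((b - a) / 2), L x) + ∫ x in Ioo 0 ((b - a) / 2), R x := by
  have hh : 0 ≤ (b - a) / 2 := by linarith
  rw [← setIntegral_congr_fun measurableSet_Ioo hL, ← setIntegral_congr_fun measurableSet_Ioo hR]
  rw [← integrableOn_congr_fun hL measurableSet_Ioo,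
    ← intervalIntegrable_iff_integrableOn_Ioo_of_le hh] at hLi
  rw [← integrableOn_congr_fun hR measurableSet_Ioo,
    ← intervalIntegrable_iff_integrableOn_Ioo_of_le hh] at hRi
  have e1 : IntervalIntegrable Φ volume a ((a + b) / 2) := by
    have := hLi.comp_add_left (-a)
    simp only [add_neg_cancel_left, sub_neg_eq_add, zero_add] at this
    rwa [show (b - a) / 2 + a = (a + b) / 2 by ring] at this
  have e2 : IntervalIntegrable Φ volume ((a + b) / 2) b := by
    have := (hRi.comp_sub_left b).symm
    simp only [sub_sub_cancel, sub_zero] at this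
    rwa [show b - (b - a) / 2 = (a + b) / 2 by ring] at this
  simp only [← integral_Ioc_eq_integral_Ioo]
  rw [← intervalIntegral.integral_of_le hab.le, ← intervalIntegral.integral_of_le hh,
    ← intervalIntegral.integral_of_le hh, intervalIntegral.integral_comp_add_left,
    intervalIntegral.integral_comp_sub_left, add_zero, sub_zero,
    show a + (b - a) / 2 = (a + b) / 2 by ring, show b - (b - a) / 2 = (a + b) / 2 by ring]
  exact (intervalIntegral.integral_add_adjacent_intervals e1 e2).symm

lemma integrableOn_halves {a b : ℝ} {Φ : ℝ → ℝ} (hab : a < b) (hΦ : IntegrableOn Φ (Ioo a b)) :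
    IntegrableOn (fun x => Φ (a + x)) (Ioo 0 ((b - a) / 2)) ∧
      IntegrableOn (fun x => Φ (b - x)) (Ioo 0 ((b - a) / 2)) := by
  have hh : 0 ≤ (b - a) / 2 := by linarith
  rw [← intervalIntegrable_iff_integrableOn_Ioo_of_le hab.le] at hΦ
  rw [← intervalIntegrable_iff_integrableOn_Ioo_of_le hh,
    ← intervalIntegrable_iff_integrableOn_Ioo_of_le hh]
  have hmem : (a + b) / 2 ∈ uIcc a b := by
    rw [uIcc_of_le hab.le]; constructor <;> linarith
  constructor
  · have := (hΦ.mono_set (uIcc_subset_uIcc_left hmem)).comp_add_left a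
    rwa [sub_self, show (a + b) / 2 - a = (b - a) / 2 by ring] at this
  · have := (hΦ.mono_set (uIcc_subset_uIcc_right hmem)).symm.comp_sub_left b
    rwa [sub_self, show b - (a + b) / 2 = (b - a) / 2 by ring] at this

theorem stmt_6 (m ν lam c jν a b : ℝ) (f f' : ℝ → ℝ)
    (hm : 0 < m) (hν : ν ∈ Set.Ioc 0 (1 / m))
    (hlam : lam ∈ Set.Ico 0 ((1 + ν * m) / 2))
    (hc : 0 < c)
    (hjν_pos : 0 < jν) (hjν_zero : besselJ ν jν = 0)
    (hjν_first : ∀ t ∈ Set.Ioo 0 jν, 0 < besselJ ν t)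
    (hcm : 2 * c / m ∈ Set.Ioo 0 jν)
    (hroot : (1 - 2 * lam) * besselJ ν (2 * c / m)
      + 2 * c * deriv (besselJ ν) (2 * c / m) = 0)
    (hab : a < b)
    (hf'int : IntegrableOn f' (Set.Icc a b))
    (hf : ∀ x ∈ Set.Icc a b, f x = ∫ t in a..x, f' t)
    (hfb : f b = 0)
    (hL1 : IntegrableOn (fun x => f' x / min (b - x) (x - a)) (Set.Ioo a b)) :
    (1 - ν ^ 2 * m ^ 2) / 4 * (∫ x in Set.Ioo a b, |f x| / (min (b - x) (x - a)) ^ 2)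
      + c ^ 2 / ((b - a) / 2) ^ m *
        (∫ x in Set.Ioo a b, |f x| / (min (b - x) (x - a)) ^ ((2:ℝ) - m))
    ≤ ((1 + ν * m) / 2 - lam ^ 2) * (∫ x in Set.Ioo a b, |f' x| / min (b - x) (x - a))
      + (lam ^ 2 - lam) / ((b - a) / 2) * (∫ x in Set.Ioo a b, |f' x|) := by
  obtain ⟨hν0, hν1⟩ := hν
  have hνm : ν * m ≤ 1 := by rwa [le_div_iff₀ hm] at hν1
  set h : ℝ := (b - a) / 2 with hh_def
  have hh : 0 < h := by rw [hh_def]; linarith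
  have hr : 0 < c / m := by positivity
  have hE : ∀ s ∈ Icc 0 ((c / m) ^ 2), 0 < besselE ν s := by
    intro s hs
    rcases hs.1.eq_or_lt with h0 | h0
    · have e : besselE ν 0 = 1 / Real.Gamma (1 + ν) := by
        rw [besselE, tsum_eq_single 0 fun k hk => by simp [hk]]
        simp
      rw [← h0, e]
      exact one_div_pos.2 (Real.Gamma_pos_of_pos (by linarith))
    · have hsq : 0 < √s := Real.sqrt_pos.2 h0
      have hsle : √s ≤ c / m := Real.sqrt_le_iff.2 ⟨hr.le, hs.2⟩
      have hJ := hjν_first (2 * √s) ⟨by positivity, lt_of_le_of_lt (by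
        rw [mul_div_assoc]; gcongr) hcm.2⟩
      rw [besselJ_eq (by positivity), mul_pow, Real.sq_sqrt h0.le,
        show (2 : ℝ) ^ 2 * s / 4 = s by ring] at hJ
      exact pos_of_mul_pos_right hJ (by positivity)
  have hroot' : lam = (1 + ν * m) / 2
      - m * ((c / m) ^ 2 * besselE (ν + 1) ((c / m) ^ 2) / besselE ν ((c / m) ^ 2)) := by
    have hne := (hE _ ⟨by positivity, le_rfl⟩).ne'
    have hpow : (c / m) ^ ν ≠ 0 := (Real.rpow_pos_of_pos hr ν).ne'
    rw [(hasDerivAt_besselJ hν0.le hcm.1).deriv, besselJ_eq hcm.1,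
      show 2 * c / m / 2 = c / m by ring, show (2 * c / m) ^ 2 / 4 = (c / m) ^ 2 by ring] at hroot
    have hroot2 : (c / m) ^ ν * ((1 - 2 * lam + ν * m) * besselE ν ((c / m) ^ 2)
        - 2 * m * ((c / m) ^ 2 * besselE (ν + 1) ((c / m) ^ 2))) = 0 := by
      rw [← hroot]
      field_simp
      ring
    have hroot3 := (mul_eq_zero.1 hroot2).resolve_left hpow
    rw [mul_div_assoc', eq_sub_iff_add_eq, ← eq_sub_iff_add_eq', div_eq_iff hne]
    linarith
  have hfi : IntervalIntegrable f' volume a b :=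
    (intervalIntegrable_iff_integrableOn_Icc_of_le hab.le).2 hf'int
  have hfi_sub : ∀ x ∈ Icc a b, IntervalIntegrable f' volume a x ∧
      IntervalIntegrable f' volume x b := fun x hx => by
    have hx' : x ∈ uIcc a b := by rwa [uIcc_of_le hab.le]
    exact ⟨hfi.mono_set (uIcc_subset_uIcc_left hx'), hfi.mono_set (uIcc_subset_uIcc_right hx')⟩
  have hfc : ContinuousOn f (Icc a b) :=
    (intervalIntegral.continuousOn_primitive_interval (by
      rwa [uIcc_of_le hab.le])).congr (by rwa [uIcc_of_le hab.le]) |>.mono (by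
      rw [uIcc_of_le hab.le])
  have hmin_left : ∀ x ∈ Ioo 0 h, min (b - (a + x)) (a + x - a) = x := fun x hx => by
    rw [add_sub_cancel_left]
    exact min_eq_right (by linarith [hx.2])
  have hmin_right : ∀ x ∈ Ioo 0 h, min (b - (b - x)) (b - x - a) = x := fun x hx => by
    rw [sub_sub_cancel]
    exact min_eq_left (by linarith [hx.2])
  have hmem_left : ∀ x ∈ Ioo 0 h, a + x ∈ Icc a b := fun x hx => by
    constructor <;> linarith [hx.1, hx.2]
  have hmem_right : ∀ x ∈ Ioo 0 h, b - x ∈ Icc a b := fun x hx => by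
    constructor <;> linarith [hx.1, hx.2]
  obtain ⟨hl, hr'⟩ := integrableOn_halves hab (hf'int.mono_set Ioo_subset_Icc_self)
  obtain ⟨hlx, hrx⟩ := integrableOn_halves hab hL1
  have hlx' : IntegrableOn (fun x => f' (a + x) / x) (Ioo 0 h) :=
    (integrableOn_congr_fun (fun x hx => by simp only [hmin_left x hx]) measurableSet_Ioo).1 hlx
  have hrx' : IntegrableOn (fun x => f' (b - x) / x) (Ioo 0 h) :=
    (integrableOn_congr_fun (fun x hx => by simp only [hmin_right x hx]) measurableSet_Ioo).1 hrx
  have habs : ∀ {u : ℝ → ℝ}, IntegrableOn (fun x => u x / x) (Ioo 0 h) →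
      IntegrableOn (fun x => |u x| / x) (Ioo 0 h) := fun hu =>
    (integrableOn_congr_fun (fun x hx => by
      rw [abs_div, abs_of_pos hx.1]) measurableSet_Ioo).1 hu.abs
  obtain ⟨l1, l2, l3⟩ := besselHardy_halfInterval (g := fun x => f (a + x)) hm hν0 hνm hlam.1 hc
    hE hroot' hh (hfc.comp (by fun_prop) hmem_left) hl hlx' (fun x hx => by
      rw [hf _ (hmem_left x hx), ← integral_Ioc_eq_integral_Ioo,
        ← intervalIntegral.integral_of_le hx.1.le,
        intervalIntegral.integral_comp_add_left (fun t => |f' t|), add_zero]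
      exact intervalIntegral.abs_integral_le_integral_abs (by linarith [hx.1]))
  obtain ⟨r1, r2, r3⟩ := besselHardy_halfInterval (g := fun x => f (b - x)) hm hν0 hνm hlam.1 hc
    hE hroot' hh (hfc.comp (by fun_prop) hmem_right) hr' hrx' (fun x hx => by
      have hsum := intervalIntegral.integral_add_adjacent_intervals
        (hfi_sub _ (hmem_right x hx)).1 (hfi_sub _ (hmem_right x hx)).2
      rw [← hf _ (hmem_right x hx), ← hf _ ⟨hab.le, le_rfl⟩, hfb] at hsum
      rw [eq_neg_of_add_eq_zero_left hsum, abs_neg, ← integral_Ioc_eq_integral_Ioo,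
        ← intervalIntegral.integral_of_le hx.1.le,
        intervalIntegral.integral_comp_sub_left (fun t => |f' t|), sub_zero]
      exact intervalIntegral.abs_integral_le_integral_abs (by linarith [hx.1]))
  rw [← integral_const_mul ((1 - ν ^ 2 * m ^ 2) / 4), ← integral_const_mul (c ^ 2 / h ^ m),
    integral_Ioo_eq_add_halves hab (fun x hx => by rw [hmin_left x hx])
      (fun x hx => by rw [hmin_right x hx]) l1 r1,
    integral_Ioo_eq_add_halves hab (fun x hx => by rw [hmin_left x hx])
      (fun x hx => by rw [hmin_right x hx]) l2 r2,
    integral_Ioo_eq_add_halves hab (fun x hx => by rw [hmin_left x hx])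
      (fun x hx => by rw [hmin_right x hx]) (habs hlx') (habs hrx'),
    integral_Ioo_eq_add_halves (Φ := fun x => |f' x|) hab (fun x hx => rfl) (fun x hx => rfl) hl.abs hr'.abs]
  rw [← hh_def]
  linarith [l3, r3]
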